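/- arXiv:1506.06181 — 2 statements merged into one kernel-verified Lean document; each statement's English description precedes it below -/
import Mathlib

section
/- Let 𝒴 = ℝ^d × 𝕋^d, let ρ^OU(p) be the standard Gaussian density on ℝ^d, let ρ₀ : 𝕋^d → (0,∞) be a smooth probability density, and set ρ⁰(p,r) = ρ^OU(p) ρ₀(r). Let h : 𝕋^d → ℝ^d be bounded with K₀ = sup_r |h(r)|. Then for all f, g in the weighted Sobolev space with f, g, ∇_p f, ∇_p g ∈ L²(𝒴; ρ⁰), one has |⟨h(r)·p, f g⟩_{L²(𝒴;ρ⁰)}| ≤ K₀ (‖f‖_{L²(𝒴;ρ⁰)} ‖∇_p g‖_{L²(𝒴;ρ⁰)} + ‖∇_p f‖_{L²(𝒴;ρ⁰)} ‖g‖_{L²(𝒴;ρ⁰)}). -/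
open MeasureTheory Real Filter

noncomputable section

/-- The standard Gaussian (Ornstein–Uhlenbeck invariant) density on ℝ^d. -/
def gaussDensity (d : ℕ) (p : Fin d → ℝ) : ℝ :=
  (2 * π) ^ (-(d : ℝ) / 2) * Real.exp (-(∑ i, p i ^ 2) / 2)

/-- Partial derivative in the i-th p-coordinate. -/
def pd (d : ℕ) (i : Fin d) (f : (Fin d → ℝ) × (Fin d → ℝ) → ℝ) :
    (Fin d → ℝ) × (Fin d → ℝ) → ℝ :=
  fun x => fderiv ℝ (fun p => f (p, x.2)) x.1 (Pi.single i 1)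

/-- Partial derivative in the i-th r-coordinate. -/
def rd (d : ℕ) (i : Fin d) (f : (Fin d → ℝ) × (Fin d → ℝ) → ℝ) :
    (Fin d → ℝ) × (Fin d → ℝ) → ℝ :=
  fun x => fderiv ℝ (fun r => f (x.1, r)) x.2 (Pi.single i 1)

/-- Reference measure on 𝒴 = ℝ^d × 𝕋^d : Lebesgue on ℝ^d times Lebesgue on a
fundamental domain (unit cube) of the torus. -/
def refMeas (d : ℕ) : Measure ((Fin d → ℝ) × (Fin d → ℝ)) :=
  (volume : Measure (Fin d → ℝ)).prod
    ((volume : Measure (Fin d → ℝ)).restrict (Set.Icc 0 1))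

/-- Product reference density ρ⁰(p,r) = ρ^OU(p) ρ₀(r). -/
def rho0 (d : ℕ) (ρ₀ : (Fin d → ℝ) → ℝ) (x : (Fin d → ℝ) × (Fin d → ℝ)) : ℝ :=
  gaussDensity d x.1 * ρ₀ x.2

/-- Integral against the weight ρ⁰ on 𝒴. -/
def wInt (d : ℕ) (ρ₀ : (Fin d → ℝ) → ℝ) (F : (Fin d → ℝ) × (Fin d → ℝ) → ℝ) : ℝ :=
  ∫ x, F x * rho0 d ρ₀ x ∂refMeas d

/-- ℤ^d-periodicity in the r-variable (i.e. f is a function on ℝ^d × 𝕋^d). -/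
def PeriodicR (d : ℕ) (f : (Fin d → ℝ) × (Fin d → ℝ) → ℝ) : Prop :=
  ∀ x : (Fin d → ℝ) × (Fin d → ℝ), ∀ i : Fin d, f (x.1, x.2 + Pi.single i 1) = f x

/-- The transport operator ℬ f = p·∇_r f + b(r)·∇_p f. -/
def Bop (d : ℕ) (b : (Fin d → ℝ) → Fin d → ℝ)
    (f : (Fin d → ℝ) × (Fin d → ℝ) → ℝ) : (Fin d → ℝ) × (Fin d → ℝ) → ℝ :=
  fun x => (∑ i, x.1 i * rd d i f x) + ∑ i, b x.2 i * pd d i f x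

/-- The kinetic (hypoelliptic) operator
ℒ^m f = (1/m)(-p·∇_p f + Δ_p f) + (1/√m) ℬ f. -/
def Lkin (d : ℕ) (m : ℝ) (b : (Fin d → ℝ) → Fin d → ℝ)
    (f : (Fin d → ℝ) × (Fin d → ℝ) → ℝ) : (Fin d → ℝ) × (Fin d → ℝ) → ℝ :=
  fun x => (1 / m) * ((- ∑ i, x.1 i * pd d i f x) + ∑ i, pd d i (pd d i f) x)
    + (1 / Real.sqrt m) * Bop d b f x

/-- The function h(r) = b(r) - ∇_r log ρ₀(r), componentwise. -/
def hfun (d : ℕ) (b : (Fin d → ℝ) → Fin d → ℝ) (ρ₀ : (Fin d → ℝ) → ℝ)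
    (r : Fin d → ℝ) (i : Fin d) : ℝ :=
  b r i - fderiv ℝ ρ₀ r (Pi.single i 1) / ρ₀ r

/-- Weighted Cauchy–Schwarz. -/
lemma weighted_cs {X : Type*} [TopologicalSpace X] [MeasurableSpace X] [OpensMeasurableSpace X]
    [SecondCountableTopology X] (μ : Measure X) (u v w : X → ℝ)
    (hu : Continuous u) (hv : Continuous v) (hw : Continuous w)
    (hu0 : ∀ x, 0 ≤ u x) (hv0 : ∀ x, 0 ≤ v x) (hw0 : ∀ x, 0 ≤ w x)
    (hu2 : Integrable (fun x => u x ^ 2 * w x) μ)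
    (hv2 : Integrable (fun x => v x ^ 2 * w x) μ) :
    Integrable (fun x => u x * v x * w x) μ ∧
      ∫ x, u x * v x * w x ∂μ ≤
        Real.sqrt (∫ x, u x ^ 2 * w x ∂μ) * Real.sqrt (∫ x, v x ^ 2 * w x ∂μ) := by
  have eu : ∀ x, (u x * Real.sqrt (w x)) ^ 2 = u x ^ 2 * w x := fun x => by
    rw [mul_pow, Real.sq_sqrt (hw0 x)]
  have ev : ∀ x, (v x * Real.sqrt (w x)) ^ 2 = v x ^ 2 * w x := fun x => by
    rw [mul_pow, Real.sq_sqrt (hw0 x)]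
  have euv : ∀ x, (u x * Real.sqrt (w x)) * (v x * Real.sqrt (w x)) = u x * v x * w x :=
    fun x => by
      have := Real.mul_self_sqrt (hw0 x)
      calc _ = u x * v x * (Real.sqrt (w x) * Real.sqrt (w x)) := by ring
        _ = _ := by rw [this]
  have mu : MemLp (fun x => u x * Real.sqrt (w x)) 2 μ := by
    rw [memLp_two_iff_integrable_sq (Continuous.aestronglyMeasurable (by fun_prop))]
    simpa only [eu] using hu2
  have mv : MemLp (fun x => v x * Real.sqrt (w x)) 2 μ := by
    rw [memLp_two_iff_integrable_sq (Continuous.aestronglyMeasurable (by fun_prop))]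
    simpa only [ev] using hv2
  constructor
  · have := mu.integrable_mul mv
    refine this.congr (ae_of_all _ fun x => ?_)
    exact euv x
  · have h2 : ENNReal.ofReal 2 = 2 := by norm_num
    have := integral_mul_le_Lp_mul_Lq_of_nonneg (μ := μ) Real.HolderConjugate.two_two
      (f := fun x => u x * Real.sqrt (w x)) (g := fun x => v x * Real.sqrt (w x))
      (ae_of_all _ fun x => mul_nonneg (hu0 x) (Real.sqrt_nonneg _))
      (ae_of_all _ fun x => mul_nonneg (hv0 x) (Real.sqrt_nonneg _))
      (by rw [h2]; exact mu) (by rw [h2]; exact mv)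
    simpa only [euv, Real.rpow_two, eu, ev, ← Real.sqrt_eq_rpow] using this

lemma gaussDensity_continuous (d : ℕ) : Continuous (gaussDensity d) := by
  unfold gaussDensity; fun_prop

lemma gaussDensity_nonneg (d : ℕ) (p : Fin d → ℝ) : 0 ≤ gaussDensity d p := by
  unfold gaussDensity; positivity

lemma slice_fderiv (d : ℕ) (f : (Fin d → ℝ) × (Fin d → ℝ) → ℝ) (hf : ContDiff ℝ 1 f)
    (x : (Fin d → ℝ) × (Fin d → ℝ)) (v : Fin d → ℝ) :
    fderiv ℝ (fun p => f (p, x.2)) x.1 v = fderiv ℝ f x (v, 0) := by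
  have h1 : HasFDerivAt f (fderiv ℝ f x) (x.1, x.2) :=
    (hf.differentiable one_ne_zero x).hasFDerivAt
  have h2 := HasFDerivAt.comp (f := fun p : Fin d → ℝ => (p, x.2)) x.1 h1
    (hasFDerivAt_prodMk_left (𝕜 := ℝ) x.1 x.2)
  have h3 : fderiv ℝ (fun p => f (p, x.2)) x.1 = _ := h2.fderiv
  rw [h3]; rfl

lemma pd_continuous (d : ℕ) (i : Fin d) (f : (Fin d → ℝ) × (Fin d → ℝ) → ℝ)
    (hf : ContDiff ℝ 1 f) : Continuous (pd d i f) := by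
  have : pd d i f = fun x => fderiv ℝ f x (Pi.single i 1, 0) := by
    funext x; exact slice_fderiv d f hf x _
  rw [this]
  exact (hf.continuous_fderiv one_ne_zero).clm_apply continuous_const

lemma slice_fderiv_sum (d : ℕ) (f : (Fin d → ℝ) × (Fin d → ℝ) → ℝ)
    (p r v : Fin d → ℝ) :
    fderiv ℝ (fun p => f (p, r)) p v = ∑ i, v i * pd d i f (p, r) := by
  conv_lhs => rw [← Finset.univ_sum_single v]
  rw [map_sum]
  refine Finset.sum_congr rfl fun i _ => ?_
  have : (Pi.single i (v i) : Fin d → ℝ) = v i • Pi.single i 1 := by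
    rw [← Pi.single_smul]; simp
  rw [this, map_smul]; rfl

lemma gauss_fderiv (d : ℕ) (p v : Fin d → ℝ) :
    DifferentiableAt ℝ (gaussDensity d) p ∧
    fderiv ℝ (gaussDensity d) p v = -(∑ i, v i * p i) * gaussDensity d p := by
  have hd : Differentiable ℝ (gaussDensity d) := by
    unfold gaussDensity; fun_prop
  refine ⟨hd p, ?_⟩
  have h1 : HasDerivAt (fun t : ℝ => gaussDensity d (p + t • v))
      (fderiv ℝ (gaussDensity d) p v) 0 := by
    have := (hd p).hasFDerivAt.hasLineDerivAt v
    exact this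
  have h2 : HasDerivAt (fun t : ℝ => gaussDensity d (p + t • v))
      (-(∑ i, v i * p i) * gaussDensity d p) 0 := by
    have h3 : HasDerivAt (fun t : ℝ => ∑ i, (p i + t * v i) ^ 2) (∑ i, 2 * p i * v i) 0 := by
      refine HasDerivAt.fun_sum fun i _ => ?_
      have := (((hasDerivAt_id (0:ℝ)).mul_const (v i)).const_add (p i)).pow 2
      convert! this using 1
      simp
    have h4 := ((h3.neg.div_const 2).exp).const_mul ((2 * π) ^ (-(d : ℝ) / 2))
    unfold gaussDensity
    convert! h4 using 1
    simp only [zero_mul, add_zero, mul_assoc, ← Finset.mul_sum, Pi.neg_apply]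
    simp only [mul_comm (v _)]
    ring
  exact h1.unique h2

/-- Cauchy–Schwarz for finite sums in the form needed. -/
lemma sum_cs (d : ℕ) (a b : Fin d → ℝ) (K : ℝ) (hK : Real.sqrt (∑ i, a i ^ 2) ≤ K) :
    |∑ i, a i * b i| ≤ K * Real.sqrt (∑ i, b i ^ 2) := by
  have h1 : |∑ i, a i * b i| ≤ Real.sqrt (∑ i, a i ^ 2) * Real.sqrt (∑ i, b i ^ 2) := by
    rw [← Real.sqrt_mul (Finset.sum_nonneg fun i _ => sq_nonneg _)]
    exact Real.abs_le_sqrt (Finset.sum_mul_sq_le_sq_mul_sq _ _ _)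
  exact h1.trans (mul_le_mul_of_nonneg_right hK (Real.sqrt_nonneg _))

/-- Lemma 6.2 of the paper: the weighted bound
|⟨h(r)·p, f g⟩_{L²(𝒴;ρ⁰)}| ≤ K₀(‖f‖ ‖∇_p g‖ + ‖∇_p f‖ ‖g‖). -/
theorem weighted_momentum_bound (d : ℕ) (ρ₀ : (Fin d → ℝ) → ℝ)
    (h : (Fin d → ℝ) → Fin d → ℝ) (K₀ : ℝ)
    (hρsm : ContDiff ℝ (⊤ : ℕ∞) ρ₀) (hρpos : ∀ r, 0 < ρ₀ r)
    (hρprob : ∫ r in Set.Icc (0 : Fin d → ℝ) 1, ρ₀ r = 1)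
    (hK : ∀ r, Real.sqrt (∑ i, h r i ^ 2) ≤ K₀)
    (f g : (Fin d → ℝ) × (Fin d → ℝ) → ℝ)
    (hf : ContDiff ℝ 1 f) (hg : ContDiff ℝ 1 g)
    (hf2 : Integrable (fun x => f x ^ 2 * rho0 d ρ₀ x) (refMeas d))
    (hg2 : Integrable (fun x => g x ^ 2 * rho0 d ρ₀ x) (refMeas d))
    (hdf2 : Integrable (fun x => (∑ i, pd d i f x ^ 2) * rho0 d ρ₀ x) (refMeas d))
    (hdg2 : Integrable (fun x => (∑ i, pd d i g x ^ 2) * rho0 d ρ₀ x) (refMeas d)) :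
    |wInt d ρ₀ (fun x => (∑ i, h x.2 i * x.1 i) * (f x * g x))|
      ≤ K₀ * (Real.sqrt (wInt d ρ₀ (fun x => f x ^ 2)) *
                Real.sqrt (wInt d ρ₀ (fun x => ∑ i, pd d i g x ^ 2))
            + Real.sqrt (wInt d ρ₀ (fun x => ∑ i, pd d i f x ^ 2)) *
                Real.sqrt (wInt d ρ₀ (fun x => g x ^ 2))) := by
  have hK0 : 0 ≤ K₀ := (Real.sqrt_nonneg _).trans (hK 0)
  have cρ : Continuous (rho0 d ρ₀) := by
    have h1 := gaussDensity_continuous d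
    have h2 := hρsm.continuous
    unfold rho0; fun_prop
  have ρ0 : ∀ x, 0 ≤ rho0 d ρ₀ x := fun x =>
    mul_nonneg (gaussDensity_nonneg d _) (hρpos _).le
  have cf := hf.continuous
  have cg := hg.continuous
  have cdf := fun i => pd_continuous d i f hf
  have cdg := fun i => pd_continuous d i g hg
  have nf : ∀ x, 0 ≤ ∑ i, pd d i f x ^ 2 := fun x => Finset.sum_nonneg fun i _ => sq_nonneg _
  have ng : ∀ x, 0 ≤ ∑ i, pd d i g x ^ 2 := fun x => Finset.sum_nonneg fun i _ => sq_nonneg _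
  have csf : Continuous fun x => Real.sqrt (∑ i, pd d i f x ^ 2) := by fun_prop
  have csg : Continuous fun x => Real.sqrt (∑ i, pd d i g x ^ 2) := by fun_prop
  obtain ⟨i0, -⟩ := weighted_cs (refMeas d) (fun x => |f x|) (fun x => |g x|) (rho0 d ρ₀)
    cf.abs cg.abs cρ (fun _ => abs_nonneg _) (fun _ => abs_nonneg _) ρ0
    (by simpa only [sq_abs] using hf2) (by simpa only [sq_abs] using hg2)
  obtain ⟨i1, b1⟩ := weighted_cs (refMeas d) (fun x => |f x|)
    (fun x => Real.sqrt (∑ i, pd d i g x ^ 2)) (rho0 d ρ₀)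
    cf.abs csg cρ (fun _ => abs_nonneg _) (fun _ => Real.sqrt_nonneg _) ρ0
    (by simpa only [sq_abs] using hf2) (by simpa only [Real.sq_sqrt (ng _)] using hdg2)
  obtain ⟨i2, b2⟩ := weighted_cs (refMeas d) (fun x => Real.sqrt (∑ i, pd d i f x ^ 2))
    (fun x => |g x|) (rho0 d ρ₀)
    csf cg.abs cρ (fun _ => Real.sqrt_nonneg _) (fun _ => abs_nonneg _) ρ0
    (by simpa only [Real.sq_sqrt (nf _)] using hdf2) (by simpa only [sq_abs] using hg2)
  simp only [sq_abs, Real.sq_sqrt (ng _), Real.sq_sqrt (nf _)] at b1 b2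
  set G : (Fin d → ℝ) × (Fin d → ℝ) → ℝ := fun x =>
    |f x| * Real.sqrt (∑ i, pd d i g x ^ 2) * rho0 d ρ₀ x
      + Real.sqrt (∑ i, pd d i f x ^ 2) * |g x| * rho0 d ρ₀ x with hG
  have iG : Integrable G (refMeas d) := i1.add i2
  have bG : K₀ * ∫ x, G x ∂refMeas d ≤ K₀ * (Real.sqrt (wInt d ρ₀ (fun x => f x ^ 2)) *
                Real.sqrt (wInt d ρ₀ (fun x => ∑ i, pd d i g x ^ 2))
            + Real.sqrt (wInt d ρ₀ (fun x => ∑ i, pd d i f x ^ 2)) *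
                Real.sqrt (wInt d ρ₀ (fun x => g x ^ 2))) := by
    refine mul_le_mul_of_nonneg_left ?_ hK0
    rw [hG, integral_add i1 i2]
    exact add_le_add b1 b2
  refine le_trans ?_ bG
  have G0 : ∀ x, 0 ≤ G x := fun x => by
    have := ρ0 x
    simp only [hG]; positivity
  by_cases hI : Integrable
    (fun x => (∑ i, h x.2 i * x.1 i) * (f x * g x) * rho0 d ρ₀ x) (refMeas d)
  swap
  · unfold wInt
    rw [integral_undef hI, abs_zero]
    exact mul_nonneg hK0 (integral_nonneg G0)
  have i3 : Integrable (fun x => f x * g x * rho0 d ρ₀ x) (refMeas d) := by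
    refine i0.mono' (Continuous.aestronglyMeasurable (by fun_prop)) (ae_of_all _ fun x => ?_)
    simp only [Real.norm_eq_abs, abs_mul, abs_of_nonneg (ρ0 x), le_refl]
  unfold wInt
  unfold refMeas at hI iG i3 ⊢
  rw [integral_prod_symm _ hI, integral_prod_symm _ iG, ← integral_const_mul, ← Real.norm_eq_abs]
  refine norm_integral_le_of_norm_le (iG.integral_prod_right.const_mul K₀) ?_
  filter_upwards [hI.prod_left_ae, iG.prod_left_ae, i3.prod_left_ae] with r jI jG j0
  have cr : Continuous fun p : Fin d → ℝ => (p, r) := by fun_prop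
  have dF : Differentiable ℝ (fun p => f (p, r)) := fun p =>
    (hf.differentiable one_ne_zero _).comp p (by fun_prop)
  have dH : Differentiable ℝ (fun p => g (p, r)) := fun p =>
    (hg.differentiable one_ne_zero _).comp p (by fun_prop)
  have e1 : ∀ p, fderiv ℝ (fun p => f (p, r) * g (p, r)) p (h r)
      = f (p, r) * (∑ i, h r i * pd d i g (p, r)) + g (p, r) * (∑ i, h r i * pd d i f (p, r)) := by
    intro p
    rw [fderiv_fun_mul (dF p) (dH p)]
    simp only [add_apply, smul_apply, smul_eq_mul, slice_fderiv_sum]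
  have dR : Differentiable ℝ (fun p => rho0 d ρ₀ (p, r)) := fun p =>
    (gauss_fderiv d p 0).1.mul_const (ρ₀ r)
  have e2 : ∀ p, fderiv ℝ (fun p => rho0 d ρ₀ (p, r)) p (h r)
      = -(∑ i, h r i * p i) * rho0 d ρ₀ (p, r) := by
    intro p
    unfold rho0
    simp only
    rw [fderiv_mul_const (gauss_fderiv d p 0).1]
    simp only [smul_apply, smul_eq_mul, (gauss_fderiv d p (h r)).2]
    ring
  have bnd : ∀ p, ‖fderiv ℝ (fun p => f (p, r) * g (p, r)) p (h r) * rho0 d ρ₀ (p, r)‖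
      ≤ K₀ * G (p, r) := by
    intro p
    rw [e1, Real.norm_eq_abs, abs_mul, abs_of_nonneg (ρ0 (p, r))]
    have c1 := sum_cs d (h r) (fun i => pd d i g (p, r)) K₀ (hK r)
    have c2 := sum_cs d (h r) (fun i => pd d i f (p, r)) K₀ (hK r)
    have c3 := abs_add_le (f (p, r) * (∑ i, h r i * pd d i g (p, r)))
      (g (p, r) * (∑ i, h r i * pd d i f (p, r)))
    rw [abs_mul, abs_mul] at c3
    have c4 := mul_le_mul_of_nonneg_left c1 (abs_nonneg (f (p, r)))
    have c5 := mul_le_mul_of_nonneg_left c2 (abs_nonneg (g (p, r)))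
    have c6 := mul_le_mul_of_nonneg_right (c3.trans (add_le_add c4 c5)) (ρ0 (p, r))
    refine c6.trans (le_of_eq ?_)
    simp only [hG]; ring
  have k1 : Integrable
      (fun p => fderiv ℝ (fun p => f (p, r) * g (p, r)) p (h r) * rho0 d ρ₀ (p, r)) := by
    refine (jG.const_mul K₀).mono' (Continuous.aestronglyMeasurable ?_) (ae_of_all _ bnd)
    simp only [e1]
    fun_prop
  have k2 : Integrable
      (fun p => f (p, r) * g (p, r) * fderiv ℝ (fun p => rho0 d ρ₀ (p, r)) p (h r)) := by
    refine jI.neg.congr (ae_of_all _ fun p => ?_)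
    simp only [e2, Pi.neg_apply]; ring
  have ibp := integral_mul_fderiv_eq_neg_fderiv_mul_of_integrable k1 k2 j0
    (fun p _ => (dF p).mul (dH p)) (fun p _ => dR p)
  have e3 : ∫ p, (∑ i, h r i * p i) * (f (p, r) * g (p, r)) * rho0 d ρ₀ (p, r)
      = ∫ p, fderiv ℝ (fun p => f (p, r) * g (p, r)) p (h r) * rho0 d ρ₀ (p, r) := by
    rw [← neg_inj, ← ibp, ← integral_neg]
    refine integral_congr_ae (ae_of_all _ fun p => ?_)
    simp only [e2]; ring
  rw [e3, ← integral_const_mul]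
  exact norm_integral_le_of_norm_le (jG.const_mul K₀) (ae_of_all _ bnd)
end
end

section
/- Let 𝒴 = ℝ^d × 𝕋^d with measure ρ⁰(p,r) dp dr where ρ⁰(p,r) = ρ^OU(p) ρ₀(r), ρ^OU the standard Gaussian density and ρ₀ a smooth positive probability density on 𝕋^d. Let b : 𝕋^d → ℝ^d be smooth and define the transport operator ℬf = p·∇_r f + b(r)·∇_p f and h(r) = b(r) - ∇_r log ρ₀(r). Then for every f ∈ C¹ with f, ∇_p f, ∇_r f ∈ L²(𝒴; ρ⁰), one has the identity ⟨f, ℬf⟩_{L²(𝒴;ρ⁰)} = (1/2) ∫_𝒴 p·h(r) |f(p,r)|² ρ⁰(p,r) dp dr. -/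
open MeasureTheory Real Filter

noncomputable section

lemma aux_pd_eq (d : ℕ) (i : Fin d) (G : (Fin d → ℝ) × (Fin d → ℝ) → ℝ)
    (hG : Differentiable ℝ G) (x) :
    pd d i G x = fderiv ℝ G x (Pi.single i 1, 0) := by
  unfold pd
  have h : HasFDerivAt (fun p => G (p, x.2))
      ((fderiv ℝ G x).comp (ContinuousLinearMap.inl ℝ _ _)) x.1 :=
    HasFDerivAt.comp (g := G) x.1 (hG (x.1, x.2)).hasFDerivAt
      (hasFDerivAt_prodMk_left x.1 x.2)
  rw [h.fderiv]; simp

lemma aux_rd_eq (d : ℕ) (i : Fin d) (G : (Fin d → ℝ) × (Fin d → ℝ) → ℝ)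
    (hG : Differentiable ℝ G) (x) :
    rd d i G x = fderiv ℝ G x (0, Pi.single i 1) := by
  unfold rd
  have h : HasFDerivAt (fun r => G (x.1, r))
      ((fderiv ℝ G x).comp (ContinuousLinearMap.inr ℝ _ _)) x.2 :=
    HasFDerivAt.comp (g := G) x.2 (hG (x.1, x.2)).hasFDerivAt
      (hasFDerivAt_prodMk_right x.1 x.2)
  rw [h.fderiv]; simp

lemma aux_pd_cont (d : ℕ) (i : Fin d) (G : (Fin d → ℝ) × (Fin d → ℝ) → ℝ)
    (hG : ContDiff ℝ 1 G) : Continuous (pd d i G) := by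
  have : pd d i G = fun x => fderiv ℝ G x (Pi.single i 1, 0) := by
    ext x; exact aux_pd_eq d i G (hG.differentiable (by simp)) x
  rw [this]
  exact (hG.continuous_fderiv (by simp)).clm_apply continuous_const

lemma aux_rd_cont (d : ℕ) (i : Fin d) (G : (Fin d → ℝ) × (Fin d → ℝ) → ℝ)
    (hG : ContDiff ℝ 1 G) : Continuous (rd d i G) := by
  have : rd d i G = fun x => fderiv ℝ G x (0, Pi.single i 1) := by
    ext x; exact aux_rd_eq d i G (hG.differentiable (by simp)) x
  rw [this]
  exact (hG.continuous_fderiv (by simp)).clm_apply continuous_const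

lemma aux_integrable (d : ℕ) (H : (Fin d → ℝ) × (Fin d → ℝ) → ℝ) (hH : Continuous H)
    (K : Set (Fin d → ℝ)) (hK : IsCompact K) (h0 : ∀ x, x.1 ∉ K → H x = 0) :
    Integrable H (refMeas d) := by
  have hm : refMeas d = (volume : Measure ((Fin d → ℝ) × (Fin d → ℝ))).restrict
      (Set.univ ×ˢ Set.Icc 0 1) := by
    unfold refMeas
    rw [Measure.volume_eq_prod, ← Measure.prod_restrict, Measure.restrict_univ]
  rw [hm]
  have h1 : IntegrableOn H (K ×ˢ Set.Icc 0 1) volume :=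
    hH.continuousOn.integrableOn_compact (hK.prod isCompact_Icc)
  refine IntegrableOn.of_forall_sdiff_eq_zero h1
    (MeasurableSet.univ.prod measurableSet_Icc) ?_
  rintro x ⟨⟨_, hx⟩, hx2⟩
  exact h0 x (fun hk => hx2 ⟨hk, hx⟩)

lemma aux_periodic_integral (d : ℕ) (i : Fin d) (g : (Fin d → ℝ) → ℝ) (hg : ContDiff ℝ 1 g)
    (hper : ∀ r, g (r + Pi.single i 1) = g r) :
    ∫ r in Set.Icc (0 : Fin d → ℝ) 1, fderiv ℝ g r (Pi.single i 1) = 0 := by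
  obtain _ | n := d
  · exact i.elim0
  have key := integral_divergence_of_hasFDerivAt_off_countable' (n := n) (E := ℝ)
    (0 : Fin (n+1) → ℝ) 1 zero_le_one
    (fun j => if j = i then g else 0)
    (fun j r => if j = i then fderiv ℝ g r else 0) ∅ Set.countable_empty
    (by intro j; by_cases h : j = i
        · simp only [h, if_true]; exact hg.continuous.continuousOn
        · simp only [h, if_false]; exact continuousOn_const)
    (by intro x _ j; by_cases h : j = i
        · simp only [h, if_true]; exact (hg.differentiable (by simp) x).hasFDerivAt
        · simp only [h, if_false]; exact hasFDerivAt_const 0 x)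
    (by
      apply Continuous.integrableOn_Icc
      refine continuous_finsetSum _ fun j _ => ?_
      by_cases h : j = i
      · simp only [h, if_true]
        exact (hg.continuous_fderiv (by simp)).clm_apply continuous_const
      · simp only [h, if_false]; exact continuous_const)
  have hL : ∀ r : Fin (n+1) → ℝ,
      (∑ j, (if j = i then fderiv ℝ g r else 0) (Pi.single j 1))
        = fderiv ℝ g r (Pi.single i 1) := by
    intro r
    rw [Finset.sum_eq_single i]
    · simp
    · intro j _ h; simp [h]
    · simp
  simp only [hL] at key
  rw [key]
  refine Finset.sum_eq_zero fun j _ => ?_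
  by_cases h : j = i
  · subst h
    simp only [if_true]
    rw [sub_eq_zero]
    congr 1
    ext y
    refine Eq.trans ?_ (hper _)
    congr 1
    ext k
    refine Fin.succAboveCases j ?_ (fun k => ?_) k
    · simp
    · simp
  · simp [h]

lemma aux_int_rd (d : ℕ) (i : Fin d) (G : (Fin d → ℝ) × (Fin d → ℝ) → ℝ)
    (hG : ContDiff ℝ 1 G) (hper : PeriodicR d G)
    (K : Set (Fin d → ℝ)) (hK : IsCompact K) (h0 : ∀ x, x.1 ∉ K → G x = 0) :
    Integrable (fun x => x.1 i * rd d i G x) (refMeas d) ∧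
    ∫ x, x.1 i * rd d i G x ∂refMeas d = 0 := by
  have hI : Integrable (fun x => x.1 i * rd d i G x) (refMeas d) := by
    refine aux_integrable d _ ?_ K hK ?_
    · have := aux_rd_cont d i G hG
      fun_prop
    · intro x hx
      have : (fun r => G (x.1, r)) = fun _ => 0 := by
        ext r; exact h0 (x.1, r) hx
      simp [rd, this]
  refine ⟨hI, ?_⟩
  unfold refMeas at hI ⊢
  rw [integral_prod _ hI]
  have : ∀ p : Fin d → ℝ, ∫ r in Set.Icc (0 : Fin d → ℝ) 1, p i * rd d i G (p, r) = 0 := by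
    intro p
    rw [integral_const_mul]
    have := aux_periodic_integral d i (fun r => G (p, r)) (by fun_prop)
      (fun r => hper (p, r) i)
    simp only [rd, this, mul_zero]
  simp only [this, integral_zero]

lemma aux_int_pd (d : ℕ) (i : Fin d) (G : (Fin d → ℝ) × (Fin d → ℝ) → ℝ)
    (b : (Fin d → ℝ) → ℝ) (hb : Continuous b)
    (hG : ContDiff ℝ 1 G)
    (K : Set (Fin d → ℝ)) (hK : IsCompact K) (h0 : ∀ x, x.1 ∉ K → G x = 0) :
    Integrable (fun x => b x.2 * pd d i G x) (refMeas d) ∧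
    ∫ x, b x.2 * pd d i G x ∂refMeas d = 0 := by
  have hz : ∀ x, x.1 ∉ K → pd d i G x = 0 := by
    intro x hx
    have : (fun p => G (p, x.2)) =ᶠ[nhds x.1] fun _ => 0 := by
      filter_upwards [hK.isClosed.isOpen_compl.mem_nhds hx] with p hp
      exact h0 (p, x.2) hp
    simp [pd, this.fderiv_eq]
  have hI : Integrable (fun x => b x.2 * pd d i G x) (refMeas d) := by
    refine aux_integrable d _ ?_ K hK ?_
    · have := aux_pd_cont d i G hG
      fun_prop
    · intro x hx
      simp [hz x hx]
  refine ⟨hI, ?_⟩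
  unfold refMeas at hI ⊢
  rw [integral_prod_symm _ hI]
  have : ∀ r : Fin d → ℝ, ∫ p : Fin d → ℝ, b r * pd d i G (p, r) = 0 := by
    intro r
    rw [integral_const_mul]
    have hg : ContDiff ℝ 1 (fun p => G (p, r)) := by fun_prop
    have hs : HasCompactSupport (fun p => G (p, r)) :=
      HasCompactSupport.intro hK fun p hp => h0 (p, r) hp
    have := integral_mul_fderiv_eq_neg_fderiv_mul_of_integrable
      (μ := (volume : Measure (Fin d → ℝ)))
      (f := fun _ => (1:ℝ)) (g := fun p => G (p, r)) (v := Pi.single i 1)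
      (by simp)
      (by
        simp only [one_mul]
        exact ((hg.continuous_fderiv (by simp)).clm_apply
          continuous_const).integrable_of_hasCompactSupport (hs.fderiv_apply ℝ _))
      (by simp only [one_mul]; exact hg.continuous.integrable_of_hasCompactSupport hs)
      (fun x _ => differentiableAt_const _)
      (fun x _ => hg.differentiable (by simp) x)
    simp only [one_mul] at this
    simp only [pd, this]
    simp
  simp only [this, integral_zero]

lemma aux_gauss_contDiff (d : ℕ) : ContDiff ℝ 1 (gaussDensity d) := by
  unfold gaussDensity; fun_prop

lemma aux_gauss_fderiv (d : ℕ) (i : Fin d) (p : Fin d → ℝ) :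
    fderiv ℝ (gaussDensity d) p (Pi.single i 1) = - p i * gaussDensity d p := by
  have h1 : HasFDerivAt (fun p : Fin d → ℝ => ∑ j, p j ^ 2)
      (∑ j, (2 * p j) • (ContinuousLinearMap.proj j : (Fin d → ℝ) →L[ℝ] ℝ)) p := by
    refine HasFDerivAt.fun_sum fun j _ => ?_
    have := (hasFDerivAt_apply (𝕜 := ℝ) (F' := fun _ : Fin d => ℝ) j p).pow 2
    simpa using this
  have h2 := ((h1.fun_neg.mul_const ((2:ℝ)⁻¹)).exp).const_mul ((2 * π) ^ (-(d : ℝ) / 2))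
  have h3 : gaussDensity d = fun p => (2 * π) ^ (-(d : ℝ) / 2) *
      Real.exp (-(∑ i, p i ^ 2) * 2⁻¹) := by
    ext p; simp [gaussDensity, div_eq_mul_inv]
  rw [h3, HasFDerivAt.fderiv h2]
  simp [ContinuousLinearMap.sum_apply, Pi.single_apply]
  ring

lemma aux_cutoff (d : ℕ) (ρ₀ : (Fin d → ℝ) → ℝ)
    (b : (Fin d → ℝ) → Fin d → ℝ)
    (hρsm : ContDiff ℝ (⊤ : ℕ∞) ρ₀) (hρpos : ∀ r, 0 < ρ₀ r)
    (hρper : ∀ r : Fin d → ℝ, ∀ i : Fin d, ρ₀ (r + Pi.single i 1) = ρ₀ r)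
    (hb : ContDiff ℝ (⊤ : ℕ∞) b)
    (f : (Fin d → ℝ) × (Fin d → ℝ) → ℝ)
    (hf : ContDiff ℝ 1 f) (hfper : PeriodicR d f)
    (χ : (Fin d → ℝ) → ℝ) (hχ : ContDiff ℝ 1 χ) (hχs : HasCompactSupport χ) :
    ∫ x, (χ x.1 * (2 * (f x * Bop d b f x * rho0 d ρ₀ x) -
        (∑ i, x.1 i * hfun d b ρ₀ x.2 i) * f x ^ 2 * rho0 d ρ₀ x)
      + fderiv ℝ χ x.1 (b x.2) * (f x ^ 2 * rho0 d ρ₀ x)) ∂refMeas d = 0 := by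
  set G : (Fin d → ℝ) × (Fin d → ℝ) → ℝ := fun x => χ x.1 * (f x ^ 2 * rho0 d ρ₀ x) with hGdef
  have hρ1 : ContDiff ℝ 1 ρ₀ := hρsm.of_le (by exact_mod_cast le_top)
  have hg1 := aux_gauss_contDiff d
  have hG : ContDiff ℝ 1 G := by
    rw [hGdef]; unfold rho0; fun_prop
  have hper : PeriodicR d G := by
    intro x i
    have := hfper x i
    simp only [hGdef, rho0, this, hρper]
  have h0 : ∀ x : (Fin d → ℝ) × (Fin d → ℝ), x.1 ∉ tsupport χ → G x = 0 := by
    intro x hx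
    simp [hGdef, image_eq_zero_of_notMem_tsupport hx]
  have hR := fun i => aux_int_rd d i G hG hper (tsupport χ) hχs h0
  have hP := fun i => aux_int_pd d i G (fun r => b r i)
    (by have := hb.continuous; fun_prop) hG (tsupport χ) hχs h0
  have hrd : ∀ i x, rd d i G x = χ x.1 * (2 * f x * rd d i f x * rho0 d ρ₀ x
      + f x ^ 2 * (gaussDensity d x.1 * fderiv ℝ ρ₀ x.2 (Pi.single i 1))) := by
    rintro i ⟨p, r⟩
    have hfd : HasFDerivAt (fun r => f (p, r)) (fderiv ℝ (fun r => f (p, r)) r) r :=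
      ((by fun_prop : ContDiff ℝ 1 (fun r => f (p, r))).differentiable (by simp) r).hasFDerivAt
    have hρd := (hρ1.differentiable (by simp) r).hasFDerivAt
    have := ((hfd.pow 2).mul (hρd.const_mul (gaussDensity d p))).const_mul (χ p)
    have h2 : fderiv ℝ (fun r => G (p, r)) r = _ := this.fderiv
    simp only [rd, h2]
    simp [rho0]
    ring
  have hpd : ∀ i x, pd d i G x = χ x.1 * (2 * f x * pd d i f x * rho0 d ρ₀ x
      - f x ^ 2 * (x.1 i * rho0 d ρ₀ x))
      + fderiv ℝ χ x.1 (Pi.single i 1) * (f x ^ 2 * rho0 d ρ₀ x) := by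
    rintro i ⟨p, r⟩
    have hfd : HasFDerivAt (fun p => f (p, r)) (fderiv ℝ (fun p => f (p, r)) p) p :=
      ((by fun_prop : ContDiff ℝ 1 (fun p => f (p, r))).differentiable (by simp) p).hasFDerivAt
    have hgd := (hg1.differentiable (by simp) p).hasFDerivAt
    have hcd := (hχ.differentiable (by simp) p).hasFDerivAt
    have := hcd.mul ((hfd.pow 2).mul (hgd.mul_const (ρ₀ r)))
    have h2 : fderiv ℝ (fun p => G (p, r)) p = _ := this.fderiv
    simp only [pd, h2]
    simp [rho0, aux_gauss_fderiv]
    ring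
  have hpt : ∀ x, (χ x.1 * (2 * (f x * Bop d b f x * rho0 d ρ₀ x) -
        (∑ i, x.1 i * hfun d b ρ₀ x.2 i) * f x ^ 2 * rho0 d ρ₀ x)
      + fderiv ℝ χ x.1 (b x.2) * (f x ^ 2 * rho0 d ρ₀ x))
      = (∑ i, x.1 i * rd d i G x) + ∑ i, b x.2 i * pd d i G x := by
    intro x
    have hbs : fderiv ℝ χ x.1 (b x.2) = ∑ i, b x.2 i * fderiv ℝ χ x.1 (Pi.single i 1) := by
      conv_lhs => rw [pi_eq_sum_univ' (b x.2)]
      simp [map_sum]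
    rw [hbs]
    simp only [Bop, hrd, hpd, hfun]
    have hne := (hρpos x.2).ne'
    simp only [Finset.sum_mul, Finset.mul_sum, mul_add, ← Finset.sum_add_distrib,
      ← Finset.sum_sub_distrib]
    refine Finset.sum_congr rfl fun i _ => ?_
    simp only [rho0]
    field_simp
    ring
  simp only [hpt]
  rw [integral_add (integrable_finsetSum _ fun i _ => (hR i).1)
    (integrable_finsetSum _ fun i _ => (hP i).1),
    integral_finsetSum _ fun i _ => (hR i).1, integral_finsetSum _ fun i _ => (hP i).1]
  simp [(hR _).2, (hP _).2]

/-- The key non-antisymmetry identity for the transport operator: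
⟨f, ℬf⟩_{L²(𝒴;ρ⁰)} = (1/2) ∫ p·h(r) |f|² ρ⁰. -/
theorem transport_operator_identity (d : ℕ) (ρ₀ : (Fin d → ℝ) → ℝ)
    (b : (Fin d → ℝ) → Fin d → ℝ)
    (hρsm : ContDiff ℝ (⊤ : ℕ∞) ρ₀) (hρpos : ∀ r, 0 < ρ₀ r)
    (hρprob : ∫ r in Set.Icc (0 : Fin d → ℝ) 1, ρ₀ r = 1)
    (hρper : ∀ r : Fin d → ℝ, ∀ i : Fin d, ρ₀ (r + Pi.single i 1) = ρ₀ r)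
    (hb : ContDiff ℝ (⊤ : ℕ∞) b)
    (hbper : ∀ r : Fin d → ℝ, ∀ i j : Fin d, b (r + Pi.single i 1) j = b r j)
    (f : (Fin d → ℝ) × (Fin d → ℝ) → ℝ)
    (hf : ContDiff ℝ 1 f) (hfper : PeriodicR d f)
    (hf2 : Integrable (fun x => f x ^ 2 * rho0 d ρ₀ x) (refMeas d))
    (hdpf2 : Integrable (fun x => (∑ i, pd d i f x ^ 2) * rho0 d ρ₀ x) (refMeas d))
    (hdrf2 : Integrable (fun x => (∑ i, rd d i f x ^ 2) * rho0 d ρ₀ x) (refMeas d))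
    (hint1 : Integrable (fun x => f x * Bop d b f x * rho0 d ρ₀ x) (refMeas d))
    (hint2 : Integrable (fun x =>
      (∑ i, x.1 i * hfun d b ρ₀ x.2 i) * f x ^ 2 * rho0 d ρ₀ x) (refMeas d)) :
    wInt d ρ₀ (fun x => f x * Bop d b f x)
      = (1 / 2) * wInt d ρ₀ (fun x => (∑ i, x.1 i * hfun d b ρ₀ x.2 i) * f x ^ 2) := by
  set F : (Fin d → ℝ) × (Fin d → ℝ) → ℝ := fun x =>
    2 * (f x * Bop d b f x * rho0 d ρ₀ x) -
      (∑ i, x.1 i * hfun d b ρ₀ x.2 i) * f x ^ 2 * rho0 d ρ₀ x with hF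
  have hFint : Integrable F (refMeas d) := (hint1.const_mul 2).sub hint2
  let φ : ContDiffBump (0 : Fin d → ℝ) := ⟨1, 2, one_pos, one_lt_two⟩
  have hφ : ContDiff ℝ 1 φ := φ.contDiff
  have hφs : HasCompactSupport φ := φ.hasCompactSupport
  obtain ⟨C, hC⟩ : ∃ C, ∀ p, ‖fderiv ℝ φ p‖ ≤ C :=
    (hφs.fderiv ℝ).exists_bound_of_continuous (hφ.continuous_fderiv (by simp))
  obtain ⟨M, hM⟩ : ∃ M, ∀ r ∈ Set.Icc (0 : Fin d → ℝ) 1, ‖b r‖ ≤ M :=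
    isCompact_Icc.exists_bound_of_continuousOn hb.continuous.continuousOn
  have hC0 : 0 ≤ C := (norm_nonneg _).trans (hC 0)
  let ε : ℕ → ℝ := fun n => 1 / ((n : ℝ) + 1)
  have hε0 : ∀ n, 0 < ε n := fun n => by positivity
  have hε1 : ∀ n, ε n ≤ 1 := fun n => by
    simp only [ε]; rw [div_le_one (by positivity)]; linarith [(Nat.cast_nonneg n : (0:ℝ) ≤ n)]
  have hεt : Tendsto ε atTop (nhds 0) := tendsto_one_div_add_atTop_nhds_zero_nat
  let χ : ℕ → (Fin d → ℝ) → ℝ := fun n p => φ (ε n • p)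
  have hχ : ∀ n, ContDiff ℝ 1 (χ n) := fun n => by
    exact hφ.comp (contDiff_const_smul (ε n))
  have hχs : ∀ n, HasCompactSupport (χ n) := fun n => hφs.comp_smul (hε0 n).ne'
  have hχd : ∀ n p v, fderiv ℝ (χ n) p v = ε n * fderiv ℝ φ (ε n • p) v := by
    intro n p v
    have h1 : HasFDerivAt (fun p : Fin d → ℝ => ε n • p)
      (ε n • ContinuousLinearMap.id ℝ (Fin d → ℝ)) p := (hasFDerivAt_id p).const_smul (ε n)
    have h2 : HasFDerivAt (χ n) _ p :=
      HasFDerivAt.comp (g := (φ : (Fin d → ℝ) → ℝ)) p (hφ.differentiable (by simp) (ε n • p)).hasFDerivAt h1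
    rw [h2.fderiv]; simp
  have hae : ∀ᵐ x ∂refMeas d, x.2 ∈ Set.Icc (0 : Fin d → ℝ) 1 := by
    unfold refMeas
    exact Measure.quasiMeasurePreserving_snd.ae (ae_restrict_mem measurableSet_Icc)
  have hbc := hb.continuous
  have hmeas : ∀ n, AEStronglyMeasurable (fun x => χ n x.1 * F x +
      fderiv ℝ (χ n) x.1 (b x.2) * (f x ^ 2 * rho0 d ρ₀ x)) (refMeas d) := by
    intro n
    have c1 : Continuous (fun x : (Fin d → ℝ) × (Fin d → ℝ) => χ n x.1) :=
      (hχ n).continuous.comp continuous_fst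
    have c2 : Continuous (fun x : (Fin d → ℝ) × (Fin d → ℝ) =>
        fderiv ℝ (χ n) x.1 (b x.2)) :=
      (((hχ n).continuous_fderiv (by simp)).comp continuous_fst).clm_apply
        (hbc.comp continuous_snd)
    exact (c1.aestronglyMeasurable.mul hFint.aestronglyMeasurable).add
      (c2.aestronglyMeasurable.mul hf2.aestronglyMeasurable)
  have hlim := tendsto_integral_of_dominated_convergence (μ := refMeas d)
    (F := fun n x => χ n x.1 * F x +
      fderiv ℝ (χ n) x.1 (b x.2) * (f x ^ 2 * rho0 d ρ₀ x)) (f := F)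
    (fun x => ‖F x‖ + C * M * ‖f x ^ 2 * rho0 d ρ₀ x‖)
    hmeas (hFint.norm.add (hf2.norm.const_mul _))
    (by
      intro n
      filter_upwards [hae] with x hx
      refine (norm_add_le _ _).trans (add_le_add ?_ ?_)
      · rw [norm_mul]
        refine mul_le_of_le_one_left (norm_nonneg _) ?_
        rw [Real.norm_of_nonneg φ.nonneg]
        exact φ.le_one
      · rw [norm_mul]
        refine mul_le_mul_of_nonneg_right ?_ (norm_nonneg _)
        rw [hχd, norm_mul, Real.norm_of_nonneg (hε0 n).le]
        refine (mul_le_of_le_one_left (norm_nonneg _) (hε1 n)).trans ?_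
        exact (ContinuousLinearMap.le_opNorm _ _).trans
          (mul_le_mul (hC _) (hM _ hx) (norm_nonneg _) hC0))
    (by
      refine Eventually.of_forall fun x => ?_
      have t0 : Tendsto (fun n => ε n • x.1) atTop (nhds 0) := by
        simpa using hεt.smul_const x.1
      have t1 : Tendsto (fun n => χ n x.1) atTop (nhds 1) := by
        have := (hφ.continuous.tendsto 0).comp t0
        rwa [φ.one_of_mem_closedBall (by simp [φ])] at this
      have t2 : Tendsto (fun n => fderiv ℝ (χ n) x.1 (b x.2)) atTop (nhds 0) := by
        simp only [hχd]
        have h3 : Continuous fun p => fderiv ℝ φ p (b x.2) :=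
          (hφ.continuous_fderiv (by simp)).clm_apply continuous_const
        simpa using hεt.mul ((h3.tendsto 0).comp t0)
      simpa using (t1.mul_const (F x)).add (t2.mul_const (f x ^ 2 * rho0 d ρ₀ x)))
  have hz : ∀ n, ∫ x, (χ n x.1 * F x +
      fderiv ℝ (χ n) x.1 (b x.2) * (f x ^ 2 * rho0 d ρ₀ x)) ∂refMeas d = 0 := fun n =>
    aux_cutoff d ρ₀ b hρsm hρpos hρper hb f hf hfper (χ n) (hχ n) (hχs n)
  simp only [hz] at hlim
  have hfin : ∫ x, F x ∂refMeas d = 0 := (tendsto_nhds_unique hlim tendsto_const_nhds)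
  rw [hF, integral_sub (hint1.const_mul 2) hint2, integral_const_mul] at hfin
  unfold wInt
  linarith
end
end
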